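/- Let c_ii, c_jj be strictly positive reals and c_ij, s_ij reals satisfying c_ij^2 + s_ij^2 = c_ii·c_jj, and let θ_i, θ_j be reals with θ_j − θ_i = arg(c_ij + s_ij·i). Then, setting |V_i| = √c_ii and |V_j| = √c_jj, the original trigonometric relations are recovered: c_ij = |V_i||V_j|·cos(θ_i − θ_j) and s_ij = −|V_i||V_j|·sin(θ_i − θ_j). Consequently the alternative formulation with the consistency constraints is exact with respect to the original AC formulation. -/

import Mathlib

/-- Exactness of the alternative formulation: if c_ii, c_jj > 0, the consistency
constraints c_ij² + s_ij² = c_ii·c_jj and θ_j − θ_i = atan2(s_ij, c_ij) hold,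
then with |V_i| = √c_ii, |V_j| = √c_jj, the original trigonometric relations
c_ij = |V_i||V_j|·cos(θ_i − θ_j) and s_ij = −|V_i||V_j|·sin(θ_i − θ_j) are recovered. -/
theorem exactness_of_consistency (cii cjj cij sij θi θj : ℝ)
    (hcii : 0 < cii) (hcjj : 0 < cjj)
    (hcons : cij ^ 2 + sij ^ 2 = cii * cjj)
    (hang : θj - θi = Complex.arg ((cij : ℝ) + (sij : ℝ) * Complex.I)) :
    cij = Real.sqrt cii * Real.sqrt cjj * Real.cos (θi - θj) ∧
    sij = -(Real.sqrt cii * Real.sqrt cjj * Real.sin (θi - θj)) := by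
  have hnorm : ‖(cij : ℂ) + sij * Complex.I‖ = √cii * √cjj := by
    rw [Complex.norm_add_mul_I, hcons, Real.sqrt_mul hcii.le]
  rw [← neg_sub θj θi, Real.cos_neg, Real.sin_neg, hang, ← hnorm, mul_neg, neg_neg,
    Complex.norm_mul_cos_arg, Complex.norm_mul_sin_arg]
  simp
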